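/- arXiv:2308.09561 — 5 statements merged into one kernel-verified Lean document; each statement's English description precedes it below -/
import Mathlib

section
/- For every natural number n ≥ 1, the number of functions h : Fin n → Fin n × Fin n that are 1-orientable is at least n^(2n) · (2/e)^n · √(π/(2n)). Equivalently, if h₀, h₁ : Fin n → Fin n are independent uniformly random functions, the probability that there exists f : Fin n → Bool making x ↦ h_{f(x)}(x) a bijection is at least (e/2)^(−n) · √(π/(2n)). -/
/-- A function `h : Fin n → Fin n × Fin n`, encoding two hash functions
`h₀ = fun x => (h x).1` and `h₁ = fun x => (h x).2`, is *1-orientable* if there is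
`f : Fin n → Bool` such that `x ↦ h_{f(x)}(x)` is a bijection of `Fin n`. -/
def OneOrientable (n : ℕ) (h : Fin n → Fin n × Fin n) : Prop :=
  ∃ f : Fin n → Bool, Function.Bijective (fun x => if f x then (h x).2 else (h x).1)

open Function

/-- `t` is the parent map of a rooted tree with root `r`, the root being its own parent. -/
def IsParentMap {α : Type*} (t : α → α) (r : α) : Prop :=
  t r = r ∧ ∀ x, ∃ k, t^[k] x = r

theorem IsParentMap.eq_root {α : Type*} {t : α → α} {r x : α} (ht : IsParentMap t r)
    (hx : t x = x) : x = r := by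
  obtain ⟨k, hk⟩ := ht.2 x
  rwa [iterate_fixed hx] at hk

/-- Every point of a finite type is eventually periodic under a self-map. -/
theorem exists_iterate_mem_periodicPts {α : Type*} [Finite α] (g : α → α) (x : α) :
    ∃ k, g^[k] x ∈ periodicPts g := by
  obtain ⟨i, j, hne, hij⟩ := Finite.exists_ne_map_eq_of_infinite (fun k : ℕ => g^[k] x)
  wlog h : i < j generalizing i j
  · exact this j i hne.symm hij.symm (by omega)
  refine ⟨i, mk_mem_periodicPts (n := j - i) (by omega) ?_⟩
  change g^[j - i] (g^[i] x) = g^[i] x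
  rw [← iterate_add_apply, Nat.sub_add_cancel h.le]
  exact hij.symm

/-- A nonempty subset of a finite type can be listed without repetition, its last element being
repeated forever. -/
theorem exists_eventually_constant_enumeration {α : Type*} [Finite α] (M : Set α)
    (hM : M.Nonempty) :
    ∃ e : ℕ → α, Set.range e = M ∧ (∀ i j, e i = e j → e (i + 1) = e (j + 1)) ∧
      ∃ N, ∀ i, e (i + N) = e N := by
  obtain ⟨m, ⟨φ⟩⟩ := Finite.exists_equiv_fin M
  have hm : 0 < m := Fin.pos (φ ⟨_, hM.some_mem⟩)
  refine ⟨fun i => (φ.symm ⟨min i (m - 1), by omega⟩ : α), ?_, ?_, m - 1, ?_⟩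
  · ext x
    constructor
    · rintro ⟨i, rfl⟩
      exact Subtype.coe_prop _
    · intro hx
      refine ⟨φ ⟨x, hx⟩, ?_⟩
      have : (⟨min (φ ⟨x, hx⟩ : ℕ) (m - 1), by omega⟩ : Fin m) = φ ⟨x, hx⟩ := by
        ext
        have := (φ ⟨x, hx⟩).isLt
        simp only
        omega
      simp only [this, Equiv.symm_apply_apply]
  · intro i j hij
    have h := φ.symm.injective (Subtype.ext hij)
    simp only [Fin.mk.injEq] at h
    have : min (i + 1) (m - 1) = min (j + 1) (m - 1) := by omega
    simp only [this]
  · intro i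
    simp

/-- Joyal's correspondence: self-maps of a finite type inject into rooted trees with a marked
vertex. -/
theorem exists_joyal_injection (α : Type*) [Finite α] [Nonempty α] :
    ∃ (t : (α → α) → α → α) (r v : (α → α) → α), (∀ g, IsParentMap (t g) (r g)) ∧
      ∀ g g', t g = t g' → v g = v g' → g = g' := by
  choose! e he_range he_succ he_const using
    exists_eventually_constant_enumeration (α := α)
  have hM (g : α → α) : (periodicPts g).Nonempty :=
    ⟨_, (exists_iterate_mem_periodicPts g (Classical.arbitrary α)).choose_spec⟩
  have he_mem (g : α → α) (i : ℕ) : e (periodicPts g) i ∈ periodicPts g :=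
    (he_range _ (hM g)).subset ⟨i, rfl⟩
  have hex (g : α → α) : ∃ t : α → α,
      (∀ i, t (g (e (periodicPts g) i)) = g (e (periodicPts g) (i + 1))) ∧
        ∀ x ∉ periodicPts g, t x = g x := by
    classical
    refine ⟨fun x => if h : ∃ i, g (e (periodicPts g) i) = x then
      g (e (periodicPts g) (h.choose + 1)) else g x, fun i => ?_, fun x hx => ?_⟩
    · have h : ∃ j, g (e (periodicPts g) j) = g (e (periodicPts g) i) := ⟨i, rfl⟩
      refine (dif_pos h).trans ?_
      exact congrArg g (he_succ _ (hM g) _ _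
        ((bijOn_periodicPts g).injOn (he_mem g _) (he_mem g _) h.choose_spec))
    · refine dif_neg ?_
      rintro ⟨i, rfl⟩
      exact hx ((bijOn_periodicPts g).mapsTo (he_mem g i))
  choose t ht_cyc ht_off using hex
  have ht_iter (g : α → α) (k i : ℕ) :
      (t g)^[k] (g (e (periodicPts g) i)) = g (e (periodicPts g) (i + k)) := by
    induction k with
    | zero => rfl
    | succ k ih => rw [iterate_succ_apply', ih, ht_cyc, add_assoc]
  have hw (g : α → α) {x : α} (hx : x ∈ periodicPts g) :
      ∃ i, g (e (periodicPts g) i) = x := by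
    obtain ⟨y, hy, rfl⟩ := (bijOn_periodicPts g).surjOn hx
    obtain ⟨i, rfl⟩ := (he_range _ (hM g)).superset hy
    exact ⟨i, rfl⟩
  choose N hN using fun g => he_const _ (hM g)
  refine ⟨t, fun g => g (e (periodicPts g) (N g)), fun g => g (e (periodicPts g) 0),
    fun g => ⟨?_, fun x => ?_⟩, fun g g' hgg htv => ?_⟩
  · rw [ht_cyc, add_comm, hN]
  · obtain ⟨k, hk⟩ := exists_iterate_mem_periodicPts g x
    have hcyc {x : α} (hx : x ∈ periodicPts g) :
        ∃ k, (t g)^[k] x = g (e (periodicPts g) (N g)) := by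
      obtain ⟨i, rfl⟩ := hw g hx
      exact ⟨N g, by rw [ht_iter, hN]⟩
    induction k generalizing x with
    | zero => exact hcyc hk
    | succ k ih =>
      by_cases hx : x ∈ periodicPts g
      · exact hcyc hx
      · obtain ⟨l, hl⟩ := ih (g x) hk
        exact ⟨l + 1, by rw [iterate_succ_apply, ht_off g x hx, hl]⟩
  · have hwalk (i : ℕ) : g (e (periodicPts g) i) = g' (e (periodicPts g') i) := by
      have := ht_iter g i 0
      beta_reduce at htv
      rwa [hgg, htv, ht_iter, zero_add, eq_comm] at this
    have hper : periodicPts g = periodicPts g' := by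
      ext x
      constructor
      · intro hx
        obtain ⟨i, rfl⟩ := hw g hx
        exact hwalk i ▸ (bijOn_periodicPts g').mapsTo (he_mem g' i)
      · intro hx
        obtain ⟨i, rfl⟩ := hw g' hx
        exact hwalk i ▸ (bijOn_periodicPts g).mapsTo (he_mem g i)
    funext x
    by_cases hx : x ∈ periodicPts g
    · obtain ⟨i, rfl⟩ := (he_range _ (hM g)).superset hx
      rw [hwalk, hper]
    · rw [← ht_off g x hx, ← ht_off g' x (hper ▸ hx), hgg]

/-- The edge tuple of the tree with parent map `t`, where the edge from `σ x` to its parent gets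
label `x`, and is reversed if `s x`. -/
def treeEdges {α : Type*} (t : α → α) (σ : Equiv.Perm α) (s : α → Bool) (x : α) : α × α :=
  if s x then (t (σ x), σ x) else (σ x, t (σ x))

theorem oneOrientable_treeEdges {n : ℕ} (t : Fin n → Fin n) (σ : Equiv.Perm (Fin n))
    (s : Fin n → Bool) : OneOrientable n (treeEdges t σ s) := by
  refine ⟨s, ?_⟩
  convert σ.bijective using 2 with x
  cases h : s x <;> simp [treeEdges, h]

theorem treeEdges_injective {α : Type*} {t t' : α → α} {r r' : α} {σ σ' : Equiv.Perm α}
    {s s' : α → Bool} (ht : IsParentMap t r) (ht' : IsParentMap t' r')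
    (h : treeEdges t σ s = treeEdges t' σ' s') (hs : s (σ.symm r) = s' (σ'.symm r')) :
    t = t' ∧ σ = σ' ∧ s = s' := by
  have hedge (x : α) : (σ x = σ' x ∧ t (σ x) = t' (σ' x)) ∨
      (σ x = t' (σ' x) ∧ t (σ x) = σ' x) := by
    have hx := congrFun h x
    cases h₁ : s x <;> cases h₂ : s' x <;> simp [treeEdges, h₁, h₂] at hx <;> tauto
  have hroot (v : α) : σ' (σ.symm v) = v := by
    obtain ⟨k, hk⟩ := ht.2 v
    induction k generalizing v with
    | zero =>
      obtain rfl : v = r := hk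
      have hv := hedge (σ.symm v)
      simp only [Equiv.apply_symm_apply, ht.1] at hv
      rcases hv with hv | hv
      exacts [hv.1.symm, hv.2.symm]
    | succ k ih =>
      have hp := ih (t v) hk
      have hv := hedge (σ.symm v)
      simp only [Equiv.apply_symm_apply] at hv
      rcases hv with hv | hv
      · exact hv.1.symm
      · have := σ.symm.injective (σ'.injective (hp.trans hv.2))
        rw [← hv.2, this]
  obtain rfl : σ = σ' := by
    ext x
    simpa using (hroot (σ x)).symm
  obtain rfl : t = t' := by
    funext v
    have hv := hedge (σ.symm v)
    simp only [Equiv.apply_symm_apply] at hv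
    rcases hv with hv | hv
    exacts [hv.2, hv.2.trans hv.1]
  obtain rfl : r = r' := ht'.eq_root ht.1
  refine ⟨rfl, rfl, funext fun x => ?_⟩
  by_cases hx : σ x = r
  · simpa [← hx] using hs
  · have hx' : t (σ x) ≠ σ x := fun h' => hx (ht.eq_root h')
    have := congrFun h x
    cases h₁ : s x <;> cases h₂ : s' x <;> simp_all [treeEdges]

theorem factorial_mul_pow_le_card_oneOrientable (n : ℕ) (hn : 1 ≤ n) :
    n ^ n * n.factorial * 2 ^ n ≤
      Nat.card {h : Fin n → Fin n × Fin n // OneOrientable n h} * (n * 2) := by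
  have : Nonempty (Fin n) := ⟨⟨0, hn⟩⟩
  obtain ⟨t, r, v, ht, hinj⟩ := exists_joyal_injection (Fin n)
  let F : ((Fin n → Fin n) × Equiv.Perm (Fin n)) × (Fin n → Bool) →
      {h : Fin n → Fin n × Fin n // OneOrientable n h} × (Fin n × Bool) := fun p =>
    (⟨treeEdges (t p.1.1) p.1.2 p.2, oneOrientable_treeEdges _ _ _⟩,
      v p.1.1, p.2 (p.1.2.symm (r p.1.1)))
  have hF : Injective F := by
    rintro ⟨⟨g, σ⟩, s⟩ ⟨⟨g', σ'⟩, s'⟩ h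
    simp only [F, Prod.mk.injEq, Subtype.mk.injEq] at h
    obtain ⟨h₁, rfl, rfl⟩ := treeEdges_injective (ht g) (ht g') h.1 h.2.2
    rw [hinj g g' h₁ h.2.1]
  simpa [Nat.card_prod, Fintype.card_perm] using Nat.card_le_card_of_injective F hF

theorem shockhash_simple_bound (n : ℕ) (hn : 1 ≤ n) :
    (Nat.card {h : Fin n → Fin n × Fin n // OneOrientable n h} : ℝ) ≥
      (n : ℝ) ^ (2 * n) * (2 / Real.exp 1) ^ n * Real.sqrt (Real.pi / (2 * n)) := by
  have hcard : (n : ℝ) ^ n * n.factorial * 2 ^ n ≤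
      Nat.card {h : Fin n → Fin n × Fin n // OneOrientable n h} * (n * 2) := by
    exact_mod_cast factorial_mul_pow_le_card_oneOrientable n hn
  have hn' : (0 : ℝ) < n := by exact_mod_cast hn
  have hsqrt : Real.sqrt (2 * Real.pi * n) = n * 2 * Real.sqrt (Real.pi / (2 * n)) := by
    rw [show 2 * Real.pi * n = (n * 2 : ℝ) ^ 2 * (Real.pi / (2 * n)) by field_simp,
      Real.sqrt_mul (by positivity), Real.sqrt_sq (by positivity)]
  refine le_of_mul_le_mul_right (le_trans ?_ hcard) (by positivity : (0 : ℝ) < n * 2)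
  calc (n : ℝ) ^ (2 * n) * (2 / Real.exp 1) ^ n * Real.sqrt (Real.pi / (2 * n)) * (n * 2)
      = (n : ℝ) ^ n * (Real.sqrt (2 * Real.pi * n) * (n / Real.exp 1) ^ n) * 2 ^ n := by
        rw [hsqrt, div_pow, div_pow, two_mul n, pow_add]
        ring
    _ ≤ (n : ℝ) ^ n * n.factorial * 2 ^ n := by
        gcongr
        exact Stirling.le_factorial_stirling n
end

section
/- For every natural number n ≥ 1, the number of functions h : Fin n → Fin n × Fin n that are 1-orientable is at least n^(2n) · (2/e)^n · √π / e. Equivalently, if h₀, h₁ : Fin n → Fin n are independent uniformly random functions, the probability that there exists f : Fin n → Bool making x ↦ h_{f(x)}(x) a bijection is at least (e/2)^(−n) · e^(−1) · √π. -/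
open Finset Function

namespace ShockHash

/-- The function on the vertices selected by `S`: the second hash value on `S`, the first one
elsewhere. -/
def select {α : Type*} [DecidableEq α] (h : α → α × α) (S : Finset α) (x : α) : α :=
  if x ∈ S then (h x).2 else (h x).1

section Counting

variable {α : Type*} [DecidableEq α]

/-- Exchanging the two hash values on the elements of `S`. -/
def swapOn (S : Finset α) (h : α → α × α) (x : α) : α × α :=
  if x ∈ S then (h x).swap else h x

theorem swapOn_involutive (S : Finset α) : Involutive (swapOn S) := by
  intro h
  funext x
  by_cases hx : x ∈ S <;> simp [swapOn, hx]

theorem select_swapOn (S T : Finset α) (h : α → α × α) :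
    select (swapOn S h) T = select h (symmDiff S T) := by
  funext x
  by_cases hS : x ∈ S <;> by_cases hT : x ∈ T <;> simp [select, swapOn, mem_symmDiff, hS, hT]

variable [Fintype α]

open Classical in
/-- The number of ways to orient the edges encoded by `h`. -/
noncomputable def orientations (h : α → α × α) : ℕ :=
  #{S : Finset α | Bijective (select h S)}

open Classical in
theorem card_bijective_select (S : Finset α) :
    #{h : α → α × α | Bijective (select h S)} =
      (Fintype.card α).factorial * Fintype.card α ^ Fintype.card α := by
  have e : {h : α → α × α // Bijective (select h S)} ≃ Equiv.Perm α × (α → α) :=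
    { toFun := fun h => (Equiv.ofBijective _ h.2, fun x => (swapOn S h.1 x).2)
      invFun := fun p => ⟨swapOn S fun x => (p.1 x, p.2 x), by
        have : select (swapOn S fun x => (p.1 x, p.2 x)) S = p.1 := by
          funext x
          by_cases hx : x ∈ S <;> simp [select, swapOn, hx]
        rw [this]
        exact p.1.bijective⟩
      left_inv := by
        rintro ⟨h, hh⟩
        apply Subtype.ext
        funext x
        by_cases hx : x ∈ S <;> simp [select, swapOn, hx]
      right_inv := by
        rintro ⟨p, g⟩
        refine Prod.ext (Equiv.ext fun x => ?_) (funext fun x => ?_) <;>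
          by_cases hx : x ∈ S <;> simp [select, swapOn, hx] }
  rw [← Fintype.card_subtype, Fintype.card_congr e, Fintype.card_prod, Fintype.card_perm,
    Fintype.card_fun]

open Classical in
theorem sum_orientations :
    ∑ h : α → α × α, orientations h =
      2 ^ Fintype.card α * ((Fintype.card α).factorial * Fintype.card α ^ Fintype.card α) := by
  simp only [orientations, card_filter]
  rw [sum_comm]
  simp only [← card_filter, card_bijective_select]
  simp

open Classical in
theorem card_bijective_fst_and_select_le (D : Finset α) :
    #{h : α → α × α | Bijective (select h ∅) ∧ Bijective (select h D)} ≤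
      (Fintype.card α).factorial * ((#D).factorial * Fintype.card α ^ (Fintype.card α - #D)) := by
  let β := Equiv.Perm α × {q : Equiv.Perm α // ∀ a, ¬ a ∈ D → q a = a} × ({a // a ∉ D} → α)
  let F : {h : α → α × α // Bijective (select h ∅) ∧ Bijective (select h D)} → β := fun h =>
    (Equiv.ofBijective _ h.2.1,
      ⟨(Equiv.ofBijective _ h.2.2).trans (Equiv.ofBijective _ h.2.1).symm, fun a ha => by
        rw [Equiv.trans_apply, Equiv.symm_apply_eq]
        simp [select, ha]⟩,
      fun a => (h.1 a).2)
  have hF : Injective F := by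
    rintro ⟨h, h₁, h₂⟩ ⟨k, k₁, k₂⟩ hk
    have e₁ := congr_arg Prod.fst hk
    have e₂ := congr_arg (fun b : β => b.2.1.1) hk
    have e₃ := congr_arg (fun b : β => b.2.2) hk
    dsimp only [F] at e₁ e₂ e₃
    rw [e₁] at e₂
    have m (x : α) : select h D x = select k D x := by
      simpa using DFunLike.congr_fun e₂ x
    have p (x : α) : select h ∅ x = select k ∅ x := DFunLike.congr_fun e₁ x
    apply Subtype.ext
    funext x
    refine Prod.ext (by simpa [select] using p x) ?_
    by_cases hx : x ∈ D
    · simpa [select, hx] using m x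
    · exact congr_fun e₃ ⟨x, hx⟩
  rw [← Fintype.card_subtype]
  refine (Fintype.card_le_of_injective F hF).trans_eq ?_
  have c : Fintype.card {q : Equiv.Perm α // ∀ a, ¬ a ∈ D → q a = a} = (#D).factorial := by
    rw [← Fintype.card_congr (Equiv.Perm.subtypeEquivSubtypePerm (· ∈ D)), Fintype.card_perm,
      Fintype.card_coe]
  have c' : Fintype.card {a // a ∉ D} = Fintype.card α - #D := by
    rw [Fintype.card_subtype_compl, Fintype.card_coe]
  rw [Fintype.card_prod, Fintype.card_prod, c, Fintype.card_fun, c', Fintype.card_perm]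

open Classical in
theorem card_bijective_select_and_select (S T : Finset α) :
    #{h : α → α × α | Bijective (select h S) ∧ Bijective (select h T)} =
      #{h : α → α × α | Bijective (select h ∅) ∧ Bijective (select h (symmDiff S T))} := by
  refine card_equiv (swapOn_involutive S).toPerm fun h => ?_
  simp only [mem_filter, mem_univ, true_and, Involutive.coe_toPerm, select_swapOn,
    symmDiff_symmDiff_cancel_left]
  rw [← bot_eq_empty, symmDiff_bot]

open Classical in
theorem sum_orientations_sq_le :
    ∑ h : α → α × α, orientations h ^ 2 ≤
      2 ^ Fintype.card α * ((Fintype.card α).factorial *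
        ∑ k ∈ range (Fintype.card α + 1),
          (Fintype.card α).descFactorial k * Fintype.card α ^ (Fintype.card α - k)) := by
  have key : ∑ h : α → α × α, orientations h ^ 2 = ∑ S : Finset α, ∑ T : Finset α,
      #{h : α → α × α | Bijective (select h S) ∧ Bijective (select h T)} := by
    simp only [orientations, card_filter, sq, sum_mul_sum]
    rw [sum_comm]
    refine sum_congr rfl fun S _ => ?_
    rw [sum_comm]
    refine sum_congr rfl fun T _ => sum_congr rfl fun h _ => ?_
    by_cases hS : Bijective (select h S) <;> simp only [hS, if_true, if_false, true_and,
      false_and, one_mul, zero_mul]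
  have inner (S : Finset α) : ∑ T : Finset α,
      #{h : α → α × α | Bijective (select h S) ∧ Bijective (select h T)} =
      ∑ D : Finset α, #{h : α → α × α | Bijective (select h ∅) ∧ Bijective (select h D)} := by
    simp only [card_bijective_select_and_select S]
    exact Equiv.sum_comp (symmDiff_right_involutive S).toPerm
      (fun D => #{h : α → α × α | Bijective (select h ∅) ∧ Bijective (select h D)})
  simp only [key, inner, sum_const, smul_eq_mul, card_univ, Fintype.card_finset]
  gcongr
  refine (sum_le_sum fun D _ => card_bijective_fst_and_select_le D).trans_eq ?_
  rw [← mul_sum, ← powerset_univ, sum_powerset_apply_card (fun k =>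
    k.factorial * Fintype.card α ^ (Fintype.card α - k)), card_univ]
  congr 1
  refine sum_congr rfl fun k _ => ?_
  rw [Nat.descFactorial_eq_factorial_mul_choose, smul_eq_mul]
  ring

open Classical in
theorem sum_orientations_sq_le_card_mul :
    (∑ h : α → α × α, orientations h) ^ 2 ≤
      #{h : α → α × α | ∃ S, Bijective (select h S)} * ∑ h : α → α × α, orientations h ^ 2 := by
  have e : ∑ h ∈ {h : α → α × α | ∃ S, Bijective (select h S)}, orientations h =
      ∑ h : α → α × α, orientations h := by
    refine sum_subset (subset_univ _) fun h _ hh => ?_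
    simpa [orientations, filter_eq_empty_iff] using hh
  rw [← e]
  exact sq_sum_le_card_mul_sum_sq.trans
    (Nat.mul_le_mul_left _ (sum_le_sum_of_subset (subset_univ _)))

end Counting

/-- Partial sums of Ramanujan's `Q`-function, bounded by telescoping. -/
theorem sum_descFactorial_div_pow_le {n : ℕ} (hn : 1 ≤ n) :
    ∑ k ∈ range (n + 1), (n.descFactorial k : ℝ) / n ^ k ≤ 3 * √n := by
  set t : ℕ → ℝ := fun k => (n.descFactorial k : ℝ) / n ^ k with ht
  have hn0 : (0 : ℝ) < n := by exact_mod_cast hn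
  have t_nonneg (k : ℕ) : 0 ≤ t k := by positivity
  have t_le (k : ℕ) : t k ≤ 1 := by
    rw [ht, div_le_one (by positivity)]
    exact_mod_cast Nat.descFactorial_le_pow n k
  have step (k : ℕ) (hk : k ≤ n) : k * t k = n * (t k - t (k + 1)) := by
    simp only [ht, Nat.descFactorial_succ, pow_succ]
    push_cast [hk]
    field_simp
    ring
  have tail : ∑ k ∈ range (n + 1), k * t k ≤ n := by
    rw [sum_congr rfl fun k hk => step k (by simpa [Nat.lt_succ_iff] using hk), ← mul_sum,
      sum_range_sub']
    nlinarith [t_le 0, t_nonneg (n + 1)]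
  set m := ⌈√n⌉₊
  have hs : 1 ≤ √(n : ℝ) := Real.one_le_sqrt.2 (by exact_mod_cast hn)
  have m_ge : √n ≤ m := Nat.le_ceil _
  have m_le : (m : ℝ) ≤ √n + 1 := (Nat.ceil_lt_add_one (by positivity)).le
  have bound (k : ℕ) : t k ≤ (if k < m then 1 else 0) + k * t k / √n := by
    split_ifs with h
    · have : 0 ≤ k * t k / √n := by have := t_nonneg k; positivity
      linarith [t_le k]
    · rw [zero_add, le_div_iff₀ (by positivity), mul_comm]
      have : (m : ℝ) ≤ k := by exact_mod_cast not_lt.1 h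
      exact mul_le_mul_of_nonneg_right (m_ge.trans this) (t_nonneg k)
  calc ∑ k ∈ range (n + 1), t k
      ≤ ∑ k ∈ range (n + 1), ((if k < m then 1 else 0) + k * t k / √n) :=
        sum_le_sum fun k _ => bound k
    _ = #{k ∈ range (n + 1) | k < m} + (∑ k ∈ range (n + 1), k * t k) / √n := by
        rw [sum_add_distrib, sum_boole, sum_div]
    _ ≤ m + n / √n := by
        gcongr
        calc _ ≤ #(range m) := card_le_card fun k hk => by simp_all
          _ = m := card_range m
    _ ≤ 3 * √n := by
        rw [Real.div_sqrt]
        linarith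

end ShockHash

open ShockHash in
theorem oneOrientable_iff_exists_select {n : ℕ} (h : Fin n → Fin n × Fin n) :
    OneOrientable n h ↔ ∃ S, Bijective (select h S) := by
  constructor
  · rintro ⟨f, hf⟩
    refine ⟨univ.filter fun x => f x, ?_⟩
    convert hf using 2 with x
    simp [select]
  · rintro ⟨S, hS⟩
    refine ⟨fun x => decide (x ∈ S), ?_⟩
    simp only [decide_eq_true_eq]
    exact hS

open ShockHash in
theorem shockhash_main_bound (n : ℕ) (hn : 1 ≤ n) :
    (Nat.card {h : Fin n → Fin n × Fin n // OneOrientable n h} : ℝ) ≥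
      (n : ℝ) ^ (2 * n) * (2 / Real.exp 1) ^ n * Real.sqrt Real.pi / Real.exp 1 := by
  classical
  have hn0 : (0 : ℝ) < n := by exact_mod_cast hn
  set N : ℝ := (Nat.card {h : Fin n → Fin n × Fin n // OneOrientable n h} : ℝ) with hN
  set R : ℝ := ∑ k ∈ range (n + 1), (n.descFactorial k : ℝ) / n ^ k with hR
  have hcard : Nat.card {h : Fin n → Fin n × Fin n // OneOrientable n h} =
      #{h : Fin n → Fin n × Fin n | ∃ S, Bijective (select h S)} := by
    simp only [oneOrientable_iff_exists_select]
    rw [Nat.card_eq_fintype_card, Fintype.card_subtype]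
  have second_moment : ((2 : ℝ) ^ n * (n.factorial * (n : ℝ) ^ n)) ^ 2 ≤
      N * (2 ^ n * (n.factorial * ((n : ℝ) ^ n * R))) := by
    have h := (sum_orientations_sq_le_card_mul (α := Fin n)).trans
      (Nat.mul_le_mul_left _ sum_orientations_sq_le)
    rw [sum_orientations, ← hcard, Fintype.card_fin] at h
    have hsum : (n : ℝ) ^ n * R =
        ∑ k ∈ range (n + 1), (n.descFactorial k : ℝ) * (n : ℝ) ^ (n - k) := by
      rw [hR, mul_sum]
      refine sum_congr rfl fun k hk => ?_
      rw [pow_sub₀ _ hn0.ne' (Nat.lt_succ_iff.1 (mem_range.1 hk))]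
      ring
    rw [hsum, hN]
    exact_mod_cast h
  have hfac : (0 : ℝ) < n.factorial := by exact_mod_cast n.factorial_pos
  have hN0 : 0 ≤ N := Nat.cast_nonneg _
  have lower : (2 : ℝ) ^ n * n.factorial * (n : ℝ) ^ n ≤ N * (3 * √n) := by
    have hpos : 0 < (2 : ℝ) ^ n * (n.factorial * (n : ℝ) ^ n) := by positivity
    refine le_trans ?_ (mul_le_mul_of_nonneg_left (sum_descFactorial_div_pow_le hn) hN0)
    refine le_of_mul_le_mul_left ?_ hpos
    linarith
  have stirling := Stirling.le_factorial_stirling n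
  have hconst : 3 ≤ √2 * Real.exp 1 := by
    have : (1.4 : ℝ) ≤ √2 := Real.le_sqrt_of_sq_le (by norm_num)
    nlinarith [Real.exp_one_gt_d9]
  have hs : 0 < √(n : ℝ) := Real.sqrt_pos.2 hn0
  have hsplit : √(2 * Real.pi * n) = √2 * √Real.pi * √n := by
    rw [Real.sqrt_mul (by positivity), Real.sqrt_mul (by positivity)]
  rw [hsplit] at stirling
  set A : ℝ := (n : ℝ) ^ (2 * n) * (2 / Real.exp 1) ^ n * √Real.pi with hA
  have hA0 : 0 ≤ A := by positivity
  have hA' : A * (√2 * √n) ≤ N * (3 * √n) := by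
    refine le_trans (le_of_eq ?_) ((mul_le_mul_of_nonneg_right
      (mul_le_mul_of_nonneg_left stirling (by positivity)) (by positivity)).trans lower)
    rw [hA, two_mul, pow_add, div_pow, div_pow]
    ring
  have hA'' : A * √2 ≤ N * 3 := by
    refine le_of_mul_le_mul_right ?_ hs
    linarith
  rw [ge_iff_le, div_le_iff₀ (Real.exp_pos 1)]
  have h2 : 0 < √(2 : ℝ) := by positivity
  refine le_of_mul_le_mul_right (hA''.trans ?_) h2
  calc N * 3 ≤ N * (√2 * Real.exp 1) := by gcongr
    _ = N * Real.exp 1 * √2 := by ring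
end

section
/- For every natural number n ≥ 1, the number of surjective functions from Fin (2n) onto Fin n is at most n^(2n) · (1 − (1 − 1/n)^(2n))^n. Equivalently, if 2n balls are thrown independently and uniformly at random into n bins, the probability that every bin receives at least one ball is at most (1 − (1 − 1/n)^(2n))^n. -/
section Hitting

variable {ι β : Type*} [Fintype ι] [DecidableEq ι] [Fintype β] [DecidableEq β]

/-- The functions `ι → β` whose range contains `S`. -/
def hittingFunctions (ι : Type*) {β : Type*} [Fintype ι] [DecidableEq ι] [Fintype β]
    [DecidableEq β] (S : Finset β) : Finset (ι → β) :=
  Finset.univ.filter fun g => ∀ b ∈ S, ∃ i, g i = b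

/-- Avoiding a cell `a ∉ S` makes hitting every cell of `S` more likely: the values equal to `a`
can be thrown again among the other cells without losing any cell of `S`. -/
theorem card_hittingFunctions_mul_le {S : Finset β} {a : β} (ha : a ∉ S) :
    (hittingFunctions ι S).card * (Fintype.card β - 1) ^ Fintype.card ι ≤
      ((hittingFunctions ι S).filter fun g => ¬ ∃ i, g i = a).card *
        Fintype.card β ^ Fintype.card ι := by
  have h₁ : (Fintype.piFinset fun _ : ι => Finset.univ.erase a).card =
      (Fintype.card β - 1) ^ Fintype.card ι := by
    simp [Finset.card_erase_of_mem]
  have h₂ : (Finset.univ : Finset (ι → β)).card = Fintype.card β ^ Fintype.card ι := by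
    simp
  rw [← h₁, ← h₂, ← Finset.card_product, ← Finset.card_product]
  refine Finset.card_le_card_of_injOn
    (fun p => (fun i => if p.1 i = a then p.2 i else p.1 i,
      fun i => if p.1 i = a then a else p.2 i)) ?_ ?_
  · rintro ⟨g, r⟩ h
    simp only [hittingFunctions, Finset.coe_product, Set.mem_prod, Finset.mem_coe,
      Finset.mem_filter, Finset.mem_univ, true_and, Fintype.mem_piFinset, Finset.mem_erase,
      and_true] at h ⊢
    obtain ⟨hg, hr⟩ := h
    refine ⟨fun b hb => ?_, ?_⟩
    · obtain ⟨i, rfl⟩ := hg b hb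
      exact ⟨i, if_neg (ne_of_mem_of_not_mem hb ha)⟩
    · rintro ⟨i, hi⟩
      split_ifs at hi with h
      · exact hr i hi
      · exact h hi
  · rintro ⟨g, r⟩ h ⟨g', r'⟩ h' heq
    simp only [Finset.coe_product, Set.mem_prod, Finset.mem_coe, Fintype.mem_piFinset,
      Finset.mem_erase, Finset.mem_univ, and_true] at h h'
    simp only [Prod.mk.injEq, funext_iff] at heq ⊢
    obtain ⟨e₁, e₂⟩ := heq
    refine ⟨fun i => ?_, fun i => ?_⟩ <;>
    · have := e₁ i
      have := e₂ i
      have := h.2 i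
      have := h'.2 i
      grind

theorem card_hittingFunctions_le [Nonempty β] (S : Finset β) :
    ((hittingFunctions ι S).card : ℝ) ≤ (Fintype.card β : ℝ) ^ Fintype.card ι *
      (1 - (1 - 1 / (Fintype.card β : ℝ)) ^ Fintype.card ι) ^ S.card := by
  have hpos : (0 : ℝ) < Fintype.card β := by exact_mod_cast Fintype.card_pos
  have hone : (1 : ℝ) ≤ Fintype.card β := by exact_mod_cast Fintype.card_pos
  have hq : 0 ≤ 1 - (1 - 1 / (Fintype.card β : ℝ)) ^ Fintype.card ι := by
    have h₁ : 1 / (Fintype.card β : ℝ) ≤ 1 := by rw [div_le_one hpos]; exact hone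
    have h₂ : 0 ≤ 1 / (Fintype.card β : ℝ) := by positivity
    exact sub_nonneg.2 (pow_le_one₀ (by linarith) (by linarith))
  induction S using Finset.induction_on with
  | empty => simp [hittingFunctions]
  | insert a S ha ih =>
    have hsplit := Finset.card_filter_add_card_filter_not (s := hittingFunctions ι S)
      (fun g => ∃ i, g i = a)
    have hins : hittingFunctions ι (insert a S) =
        (hittingFunctions ι S).filter fun g => ∃ i, g i = a := by
      ext g
      simp [hittingFunctions, and_comm]
    have hle : ((hittingFunctions ι S).card : ℝ) *
        (1 - 1 / (Fintype.card β : ℝ)) ^ Fintype.card ι ≤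
          ((hittingFunctions ι S).filter fun g => ¬ ∃ i, g i = a).card := by
      have h := card_hittingFunctions_mul_le (ι := ι) ha
      rify [Nat.one_le_iff_ne_zero.2 (Fintype.card_ne_zero (α := β))] at h
      rw [one_sub_div hpos.ne', div_pow, ← mul_div_assoc, div_le_iff₀ (by positivity)]
      exact h
    rify at hsplit
    rw [hins, Finset.card_insert_of_notMem ha, pow_succ, ← mul_assoc]
    refine le_trans ?_ (mul_le_mul_of_nonneg_right ih hq)
    linarith

end Hitting

theorem filter_pass_probability_upper_bound (n : ℕ) (hn : 1 ≤ n) :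
    (Nat.card {g : Fin (2 * n) → Fin n // Function.Surjective g} : ℝ) ≤
      (n : ℝ) ^ (2 * n) * (1 - (1 - 1 / (n : ℝ)) ^ (2 * n)) ^ n := by
  have : Nonempty (Fin n) := ⟨⟨0, hn⟩⟩
  have h := card_hittingFunctions_le (ι := Fin (2 * n)) (Finset.univ : Finset (Fin n))
  have hcard : Nat.card {g : Fin (2 * n) → Fin n // Function.Surjective g} =
      (hittingFunctions (Fin (2 * n)) (Finset.univ : Finset (Fin n))).card :=
    Nat.subtype_card _ fun g => by simp [hittingFunctions, Function.Surjective]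
  rw [hcard]
  simpa using h
end

section
/- Let n ≥ 1 and let M_n denote the set of fixed-point-free involutions σ of Fin (2n) (perfect matchings of the 2n stubs). For σ ∈ M_n, let c(σ) be the number of equivalence classes of the equivalence relation on Fin n generated by relating ⌊a/2⌋ to ⌊σ(a)/2⌋ for every a ∈ Fin (2n) (the connected components of the 2-regular multigraph obtained by assigning stubs 2i and 2i+1 to node i and joining matched stubs). Then the average (1/|M_n|) · Σ_{σ ∈ M_n} 2^{c(σ)} is at most e·√(2n). -/
/-- The node owning stub `a`: stubs `2i` and `2i+1` belong to node `i`. -/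
def stubNode (n : ℕ) (a : Fin (2 * n)) : Fin n :=
  ⟨(a : ℕ) / 2, by have := a.isLt; omega⟩

/-- The number of connected components of the 2-regular multigraph obtained from the
perfect matching `σ` of the `2n` stubs: the number of equivalence classes of the
equivalence relation on `Fin n` generated by relating `⌊a/2⌋` to `⌊σ a / 2⌋`. -/
noncomputable def numComponents (n : ℕ) (σ : Equiv.Perm (Fin (2 * n))) : ℕ :=
  Nat.card (Quot (fun x y : Fin n => ∃ a : Fin (2 * n), stubNode n a = x ∧ stubNode n (σ a) = y))

open Finset

/-- If `τ` and `σ` are fixed-point-free involutions, then `τ` moves every point out of its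
`σ * τ`-cycle. -/
theorem not_sameCycle_mul_of_involutive {α : Type*} {τ σ : Equiv.Perm α}
    (hτ : Function.Involutive τ) (hτ' : ∀ a, τ a ≠ a)
    (hσ : Function.Involutive σ) (hσ' : ∀ a, σ a ≠ a) (a : α) :
    ¬ (σ * τ).SameCycle a (τ a) := by
  rintro ⟨k, hk⟩
  have hττ : τ * τ = 1 := Equiv.ext hτ
  have hσσ : σ * σ = 1 := Equiv.ext hσ
  obtain ⟨ρ, hρ⟩ : ∃ ρ, ρ = σ * τ := ⟨_, rfl⟩
  rw [← hρ] at hk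
  have hρ' : ρ⁻¹ = τ * σ := by
    rw [hρ, mul_inv_rev, inv_eq_of_mul_eq_one_left hττ, inv_eq_of_mul_eq_one_left hσσ]
  have hconj : ∀ j : ℤ, τ * ρ ^ j = ρ ^ (-j) * τ := by
    intro j
    have h : τ * ρ * τ⁻¹ = ρ⁻¹ := by
      rw [hρ', hρ, inv_eq_of_mul_eq_one_left hττ, mul_assoc, mul_assoc, hττ, mul_one]
    have h2 : (τ * ρ * τ⁻¹) ^ j = τ * ρ ^ j * τ⁻¹ := conj_zpow
    rw [h, inv_zpow'] at h2
    rw [h2, inv_mul_cancel_right]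
  have hστ : σ = ρ * τ := by rw [hρ, mul_assoc, hττ, mul_one]
  rcases Int.even_or_odd' k with ⟨j, rfl | rfl⟩
  · apply hτ' ((ρ ^ j) a)
    rw [← Equiv.Perm.mul_apply, hconj, Equiv.Perm.mul_apply, ← hk, ← Equiv.Perm.mul_apply,
      ← zpow_add]
    congr 2
    ring
  · apply hσ' ((ρ ^ (j + 1)) a)
    rw [← Equiv.Perm.mul_apply, hστ, mul_assoc, hconj, Equiv.Perm.mul_apply,
      Equiv.Perm.mul_apply, ← hk, ← Equiv.Perm.mul_apply, ← Equiv.Perm.mul_apply,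
      ← zpow_one_add, ← zpow_add]
    congr 2
    ring

/-- Two fixed-point-free involutions admit a common alternating two-colouring. -/
theorem exists_alternating_coloring {α : Type*} [LinearOrder α] {τ σ : Equiv.Perm α}
    (hτ : Function.Involutive τ) (hτ' : ∀ a, τ a ≠ a)
    (hσ : Function.Involutive σ) (hσ' : ∀ a, σ a ≠ a) :
    ∃ f : α → Bool, ∀ a, f (τ a) = !f a ∧ f (σ a) = !f a := by
  let s := Equiv.Perm.SameCycle.setoid (σ * τ)
  let r : α → α := fun a => (Quotient.mk s a).out
  have hr : ∀ {a b : α}, (σ * τ).SameCycle a b → r a = r b := fun h =>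
    congrArg Quotient.out (Quotient.sound (s := s) h)
  have hne : ∀ a, r a ≠ r (τ a) := fun a h =>
    not_sameCycle_mul_of_involutive hτ hτ' hσ hσ' a
      (Quotient.exact (s := s) (Quotient.out_injective h))
  have hσr : ∀ a, r (σ a) = r (τ a) := fun a => (hr ⟨1, by simp [hτ a]⟩).symm
  have hτσr : ∀ a, r (τ (σ a)) = r a := fun a => hr ⟨1, by simp [hτ (σ a), hσ a]⟩
  have hlt : ∀ a, decide (r (τ a) < r a) = !decide (r a < r (τ a)) := by
    intro a
    rw [← decide_not, decide_eq_decide, not_lt]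
    exact ⟨le_of_lt, fun h => h.lt_of_ne (hne a).symm⟩
  exact ⟨fun a => decide (r a < r (τ a)), fun a => ⟨by simpa only [hτ a] using hlt a,
    by simpa only [hσr, hτσr] using hlt a⟩⟩

/-- The number of fixed-point-free involutions alternating with respect to a balanced
two-colouring is at most `n!`. -/
theorem card_involutions_alternating_le {α : Type*} [Fintype α] [DecidableEq α] {n : ℕ}
    (hα : Fintype.card α = 2 * n) {τ : Equiv.Perm α} {f : α → Bool}
    (hf : ∀ a, f (τ a) = !f a) (S : Finset (Equiv.Perm α))
    (hS : ∀ σ ∈ S, (∀ a, σ (σ a) = a) ∧ ∀ a, f (σ a) = !f a) :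
    #S ≤ n.factorial := by
  let e : Equiv.Perm α → Prop := fun σ => ∀ a, f a = true ↔ ¬ f (σ a) = true
  have he : ∀ {σ : Equiv.Perm α}, (∀ a, f (σ a) = !f a) → e σ := fun h a => by simp [h a]
  let E : {a // f a = true} ≃ {a // ¬ f a = true} := τ.subtypeEquiv (he hf)
  have hcard : Fintype.card {a // f a = true} = n := by
    have h1 := Fintype.card_congr E
    have h2 := Fintype.card_subtype_compl (fun a => f a = true)
    have h3 := Fintype.card_subtype_le (fun a => f a = true)
    omega
  rw [← hcard, ← Fintype.card_equiv E, ← Fintype.card_coe]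
  refine Fintype.card_le_of_injective
    (fun σ : S => σ.1.subtypeEquiv (he (hS σ.1 σ.2).2)) ?_
  rintro ⟨σ, hσ⟩ ⟨σ', hσ'⟩ h
  have h1 : ∀ a, f a = true → σ a = σ' a := fun a ha =>
    congrArg Subtype.val (Equiv.ext_iff.1 h ⟨a, ha⟩)
  refine Subtype.ext (Equiv.ext fun a => ?_)
  rcases Bool.eq_false_or_eq_true (f a) with ha | ha
  · exact h1 a ha
  · have h2 := h1 (σ a) (by rw [(hS σ hσ).2, ha]; rfl)
    rw [(hS σ hσ).1] at h2
    change σ a = σ' a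
    nth_rw 2 [h2]
    rw [(hS σ' hσ').1]

/-- The involution exchanging the two stubs of every node. -/
def stubSwap (n : ℕ) : Equiv.Perm (Fin (2 * n)) :=
  Function.Involutive.toPerm
    (fun a => ⟨if (a : ℕ) % 2 = 0 then a + 1 else a - 1, by have := a.isLt; split <;> omega⟩)
    (fun a => by ext; dsimp only; split <;> split <;> omega)

theorem coe_stubSwap (n : ℕ) (a : Fin (2 * n)) :
    (stubSwap n a : ℕ) = if (a : ℕ) % 2 = 0 then (a : ℕ) + 1 else a - 1 := rfl

theorem stubSwap_involutive (n : ℕ) : Function.Involutive (stubSwap n) :=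
  Function.Involutive.toPerm_involutive _

theorem stubSwap_ne (n : ℕ) (a : Fin (2 * n)) : stubSwap n a ≠ a := by
  rw [Ne, Fin.ext_iff, coe_stubSwap]
  split <;> omega

theorem stubNode_stubSwap (n : ℕ) (a : Fin (2 * n)) : stubNode n (stubSwap n a) = stubNode n a := by
  simp only [stubNode, Fin.ext_iff, coe_stubSwap]
  split <;> omega

theorem stubNode_surjective (n : ℕ) : Function.Surjective (stubNode n) := fun i =>
  ⟨⟨2 * i, by omega⟩, by simp [stubNode]⟩

/-- Every matching has at least `2 ^ c` alternating two-colourings of the stubs, where `c` is the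
number of components. -/
theorem two_pow_numComponents_le (n : ℕ) (σ : Equiv.Perm (Fin (2 * n)))
    (hσ : ∀ a, σ (σ a) = a) (hσ' : ∀ a, σ a ≠ a) :
    2 ^ numComponents n σ ≤
      #{f : Fin (2 * n) → Bool | ∀ a, f (stubSwap n a) = !f a ∧ f (σ a) = !f a} := by
  classical
  obtain ⟨f₀, hf₀⟩ :=
    exists_alternating_coloring (stubSwap_involutive n) (stubSwap_ne n) hσ hσ'
  let R : Fin n → Fin n → Prop :=
    fun x y => ∃ a : Fin (2 * n), stubNode n a = x ∧ stubNode n (σ a) = y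
  let c : Fin (2 * n) → Quot R := fun a => Quot.mk R (stubNode n a)
  have hc : Function.Surjective c := Quot.mk_surjective.comp (stubNode_surjective n)
  have : Fintype (Quot R) := Fintype.ofFinite _
  have hpow : 2 ^ numComponents n σ = Fintype.card (Quot R → Bool) := by
    rw [Fintype.card_fun, Fintype.card_bool, ← Nat.card_eq_fintype_card]
    rfl
  rw [hpow, ← Finset.card_univ]
  refine Finset.card_le_card_of_injOn (fun g a => xor (f₀ a) (g (c a))) ?_ ?_
  · intro g _
    have h1 : ∀ a, c (stubSwap n a) = c a := fun a =>
      congrArg (Quot.mk R) (stubNode_stubSwap n a)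
    have h2 : ∀ a, c (σ a) = c a := fun a => (Quot.sound ⟨a, rfl, rfl⟩).symm
    simp [h1, h2, hf₀]
  · intro g _ g' _ h
    funext q
    obtain ⟨a, rfl⟩ := hc q
    simpa using congrFun h a

theorem card_colorings_le (n : ℕ) :
    #{f : Fin (2 * n) → Bool | ∀ a, f (stubSwap n a) = !f a} ≤ 2 ^ n := by
  have h : 2 ^ n = #(univ : Finset (Fin n → Bool)) := by simp
  rw [h]
  refine Finset.card_le_card_of_injOn (fun f i => f ⟨2 * i, by omega⟩)
    (fun _ _ => mem_coe.2 (mem_univ _)) ?_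
  intro f hf g hg h
  simp only [coe_filter, mem_univ, true_and, Set.mem_ofPred_eq] at hf hg
  have heven : ∀ a : Fin (2 * n), (a : ℕ) % 2 = 0 → f a = g a := by
    intro a ha
    have h1 := congrFun h ⟨(a : ℕ) / 2, by omega⟩
    have h2 : (⟨2 * ((a : ℕ) / 2), by omega⟩ : Fin (2 * n)) = a := by
      ext; dsimp only; omega
    simpa only [h2] using h1
  funext a
  by_cases ha : (a : ℕ) % 2 = 0
  · exact heven a ha
  · have h1 := heven (stubSwap n a) (by rw [coe_stubSwap, if_neg ha]; omega)
    rwa [hf, hg, Bool.not_inj_iff] at h1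

theorem sum_two_pow_numComponents_le (n : ℕ) (M : Finset (Equiv.Perm (Fin (2 * n))))
    (hM : ∀ σ ∈ M, (∀ a, σ a ≠ a) ∧ ∀ a, σ (σ a) = a) :
    ∑ σ ∈ M, 2 ^ numComponents n σ ≤ 2 ^ n * n.factorial := by
  classical
  let C : Finset (Fin (2 * n) → Bool) := {f | ∀ a, f (stubSwap n a) = !f a}
  let r : Equiv.Perm (Fin (2 * n)) → (Fin (2 * n) → Bool) → Prop :=
    fun σ f => ∀ a, f (σ a) = !f a
  calc ∑ σ ∈ M, 2 ^ numComponents n σ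
      ≤ ∑ σ ∈ M, #(C.bipartiteAbove r σ) := by
        refine Finset.sum_le_sum fun σ hσ => ?_
        refine (two_pow_numComponents_le n σ (hM σ hσ).2 (hM σ hσ).1).trans_eq ?_
        congr 1
        ext f
        simp [C, r, bipartiteAbove, forall_and]
    _ = ∑ f ∈ C, #(M.bipartiteBelow r f) := sum_card_bipartiteAbove_eq_sum_card_bipartiteBelow r
    _ ≤ ∑ _f ∈ C, n.factorial := by
        refine Finset.sum_le_sum fun f hf => ?_
        refine card_involutions_alternating_le (by simp) (τ := stubSwap n) (f := f)
          (by simpa [C] using hf) _ ?_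
        intro σ hσ
        rw [mem_bipartiteBelow] at hσ
        exact ⟨(hM σ hσ.1).2, hσ.2⟩
    _ ≤ 2 ^ n * n.factorial := by
        rw [sum_const, smul_eq_mul]
        exact Nat.mul_le_mul_right _ (card_colorings_le n)

theorem factorial_le_card_involutions_mul (n : ℕ) (hn : 1 ≤ n)
    (M : Finset (Equiv.Perm (Fin (2 * n))))
    (hM : ∀ σ : Equiv.Perm (Fin (2 * n)), (∀ a, σ a ≠ a) ∧ (∀ a, σ (σ a) = a) → σ ∈ M) :
    (2 * n).factorial ≤ #M * (2 ^ n * n.factorial) := by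
  have h := Equiv.Perm.card_of_cycleType_mul_eq (Fin (2 * n)) (Multiset.replicate n 2)
  rw [if_pos ⟨by simp [mul_comm], fun a ha => (Multiset.eq_of_mem_replicate ha).ge⟩] at h
  simp only [Fintype.card_fin, Multiset.sum_replicate, smul_eq_mul, mul_comm n 2, Nat.sub_self,
    Nat.factorial_zero, one_mul, Multiset.prod_replicate,
    Multiset.toFinset_replicate, if_neg (Nat.one_le_iff_ne_zero.1 hn), prod_singleton,
    Multiset.count_replicate_self] at h
  rw [← h]
  refine Nat.mul_le_mul_right _ (Finset.card_le_card fun σ hσ => hM σ ?_)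
  rw [mem_filter] at hσ
  constructor
  · have h1 := σ.sum_cycleType
    rw [hσ.2, Multiset.sum_replicate, smul_eq_mul] at h1
    have h2 : σ.support = univ := by
      rw [← Finset.card_eq_iff_eq_univ, ← h1, Fintype.card_fin, mul_comm]
    exact fun a => Equiv.Perm.mem_support.1 (h2 ▸ mem_univ a)
  · have h1 : orderOf σ ∣ 2 := by
      rw [← Equiv.Perm.lcm_cycleType, hσ.2, Multiset.lcm_dvd]
      intro b hb
      rw [Multiset.eq_of_mem_replicate hb]
    have h2 := orderOf_dvd_iff_pow_eq_one.1 h1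
    rw [sq] at h2
    exact fun a => DFunLike.congr_fun h2 a

theorem four_pow_sq_le (n : ℕ) (hn : 1 ≤ n) :
    (4 ^ n) ^ 2 ≤ 4 * n * n.centralBinom ^ 2 := by
  induction n, hn using Nat.le_induction with
  | base => decide
  | succ n hn ih =>
    have h := Nat.succ_mul_centralBinom_succ n
    have hpos : 0 < n + 1 := n.succ_pos
    refine Nat.le_of_mul_le_mul_left ?_ hpos
    calc (n + 1) * (4 ^ (n + 1)) ^ 2 = 16 * (n + 1) * (4 ^ n) ^ 2 := by ring
      _ ≤ 16 * (n + 1) * (4 * n * n.centralBinom ^ 2) := Nat.mul_le_mul_left _ ih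
      _ ≤ 4 * (2 * (2 * n + 1) * n.centralBinom) ^ 2 := by
        have : 16 * (n + 1) * (4 * n) ≤ 4 * (2 * (2 * n + 1)) ^ 2 := by nlinarith
        calc _ = 16 * (n + 1) * (4 * n) * n.centralBinom ^ 2 := by ring
          _ ≤ 4 * (2 * (2 * n + 1)) ^ 2 * n.centralBinom ^ 2 := Nat.mul_le_mul_right _ this
          _ = _ := by ring
      _ = (n + 1) * (4 * (n + 1) * (n + 1).centralBinom ^ 2) := by rw [← h]; ring

theorem configuration_model_expected_two_pow_components (n : ℕ) (hn : 1 ≤ n)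
    (M : Finset (Equiv.Perm (Fin (2 * n))))
    (hM : ∀ σ : Equiv.Perm (Fin (2 * n)), σ ∈ M ↔ (∀ a, σ a ≠ a) ∧ ∀ a, σ (σ a) = a) :
    (1 / (M.card : ℝ)) * ∑ σ ∈ M, (2 : ℝ) ^ numComponents n σ ≤
      Real.exp 1 * Real.sqrt (2 * n) := by
  have hsum := sum_two_pow_numComponents_le n M fun σ hσ => (hM σ).1 hσ
  have hcard := factorial_le_card_involutions_mul n hn M fun σ hσ => (hM σ).2 hσ
  have hfac : (2 * n).factorial = n.centralBinom * n.factorial * n.factorial := by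
    have h := Nat.choose_mul_factorial_mul_factorial (show n ≤ 2 * n by omega)
    rw [show 2 * n - n = n by omega] at h
    exact h.symm
  have hbinom : n.centralBinom * n.factorial ≤ #M * 2 ^ n := by
    refine Nat.le_of_mul_le_mul_right ?_ n.factorial_pos
    rw [← hfac, mul_assoc]
    exact hcard
  have hMpos : 0 < #M := Nat.pos_of_mul_pos_right
    ((Nat.mul_pos n.centralBinom_pos n.factorial_pos).trans_le hbinom)
  have hsqrt : (4 : ℝ) ^ n ≤ 2 * Real.sqrt n * n.centralBinom := by
    refine le_of_sq_le_sq ?_ (by positivity)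
    rw [mul_pow, mul_pow, Real.sq_sqrt n.cast_nonneg]
    have h := four_pow_sq_le n hn
    have h' : ((4 : ℝ) ^ n) ^ 2 ≤ 4 * n * (n.centralBinom : ℝ) ^ 2 := by exact_mod_cast h
    linarith
  have hsum' : ∑ σ ∈ M, (2 : ℝ) ^ numComponents n σ ≤ 2 ^ n * n.factorial := by
    exact_mod_cast hsum
  have hbinom' : (n.centralBinom : ℝ) * n.factorial ≤ #M * 2 ^ n := by exact_mod_cast hbinom
  have hmain : ∑ σ ∈ M, (2 : ℝ) ^ numComponents n σ ≤ 2 * Real.sqrt n * #M := by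
    refine hsum'.trans (le_of_mul_le_mul_right ?_ (show (0 : ℝ) < 2 ^ n by positivity))
    calc (2 : ℝ) ^ n * n.factorial * 2 ^ n = 4 ^ n * n.factorial := by
          rw [mul_right_comm, ← mul_pow]; norm_num
      _ ≤ 2 * Real.sqrt n * n.centralBinom * n.factorial := by gcongr
      _ = 2 * Real.sqrt n * (n.centralBinom * n.factorial) := by ring
      _ ≤ 2 * Real.sqrt n * (#M * 2 ^ n) := by gcongr
      _ = 2 * Real.sqrt n * #M * 2 ^ n := by ring
  have hexp : (2 : ℝ) ≤ Real.exp 1 := by linarith [Real.add_one_le_exp (1 : ℝ)]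
  rw [one_div, inv_mul_le_iff₀ (by exact_mod_cast hMpos), mul_comm (#M : ℝ)]
  refine hmain.trans ?_
  gcongr
  linarith [(n.cast_nonneg : (0 : ℝ) ≤ n)]
end

section
/- Let λ > 0 be the unique real solution of λ/(1 − e^(−λ)) = 2 and set b = 2e^λ/(λe²). Then the probability that a uniformly random function from Fin (2n) to Fin n is surjective is Θ(b^n): there exist constants c₁, c₂ > 0 such that for all n ≥ 1, c₁·b^n ≤ (number of surjections from Fin (2n) onto Fin n)/n^(2n) ≤ c₂·b^n. -/
open Real Filter Topology MeasureTheory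

/-- The number of surjections from `Fin m` onto `Fin n`, by inclusion-exclusion. -/
theorem card_surjective_eq_sum (m n : ℕ) :
    (Nat.card {g : Fin m → Fin n // Function.Surjective g} : ℤ) =
      ∑ k ∈ Finset.range (n + 1), (n.choose k : ℤ) * ((-1) ^ k * ((n - k : ℕ) : ℤ) ^ m) := by
  classical
  have avoid (t : Finset (Fin n)) :
      (t.inf fun i ↦ Finset.univ.filter fun g : Fin m → Fin n ↦ ∀ j, g j ≠ i) =
        Fintype.piFinset fun _ ↦ tᶜ := by
    ext g
    simp only [Finset.mem_inf, Finset.mem_filter, Finset.mem_univ, true_and,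
      Fintype.mem_piFinset, Finset.mem_compl]
    exact ⟨fun h j hj ↦ h _ hj j rfl, fun h i hi j hij ↦ h j (hij ▸ hi)⟩
  have surj : (Finset.univ.inf fun i ↦
      (Finset.univ.filter fun g : Fin m → Fin n ↦ ∀ j, g j ≠ i)ᶜ) =
        Finset.univ.filter Function.Surjective := by
    ext g
    simp [Finset.mem_inf, Function.Surjective]
  have h := Finset.inclusion_exclusion_card_inf_compl Finset.univ
    fun i ↦ Finset.univ.filter fun g : Fin m → Fin n ↦ ∀ j, g j ≠ i
  rw [surj] at h
  rw [Nat.card_eq_fintype_card, Fintype.card_subtype, h]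
  simp_rw [avoid, Fintype.card_piFinset_const, Finset.card_compl, Fintype.card_fin]
  rw [Finset.sum_powerset_apply_card (fun k ↦ (-1 : ℤ) ^ k * (((n - k) ^ m : ℕ) : ℤ))]
  simp

theorem integral_exp_mul_exp_I_mul_exp_neg (a : ℂ) (m : ℕ) :
    ∫ θ in (-π)..π, Complex.exp (a * Complex.exp (θ * Complex.I)) *
      Complex.exp (-(m * (θ * Complex.I))) = 2 * π * (a ^ m / m.factorial) := by
  have hper : Function.Periodic (fun θ : ℝ ↦ Complex.exp (a * Complex.exp (θ * Complex.I)) *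
      Complex.exp (-(m * (θ * Complex.I)))) (2 * π) := by
    intro θ
    have h1 : Complex.exp (((θ + 2 * π : ℝ) : ℂ) * Complex.I) = Complex.exp (θ * Complex.I) := by
      rw [← Complex.exp_periodic (θ * Complex.I)]
      push_cast
      ring_nf
    simp only [Complex.exp_neg, Complex.exp_nat_mul, h1]
  have hshift := hper.intervalIntegral_add_eq (-π) 0
  rw [show -π + 2 * π = π by ring, zero_add] at hshift
  rw [hshift]
  have hd : DifferentiableOn ℂ (fun z : ℂ ↦ Complex.exp (a * z)) Set.univ := by fun_prop
  have h := (hd.mono (Set.subset_univ (Metric.closedBall 0 1)))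
    |>.circleIntegral_one_div_sub_center_pow_smul one_pos m
  rw [iteratedDeriv_cexp_const_mul] at h
  simp only [circleIntegral, deriv_circleMap, sub_zero, smul_eq_mul, mul_zero, Complex.exp_zero,
    mul_one] at h
  have h2 : ∀ θ : ℝ, circleMap 0 1 θ * Complex.I * (1 / circleMap 0 1 θ ^ (m + 1) *
      Complex.exp (a * circleMap 0 1 θ)) = Complex.I *
        (Complex.exp (a * Complex.exp (θ * Complex.I)) * Complex.exp (-(m * (θ * Complex.I)))) := by
    intro θ
    have : Complex.exp (θ * Complex.I) ≠ 0 := Complex.exp_ne_zero _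
    simp only [circleMap, zero_add, Complex.ofReal_one, one_mul, Complex.exp_neg,
      Complex.exp_nat_mul]
    field_simp
    ring
  simp_rw [h2] at h
  rw [intervalIntegral.integral_const_mul] at h
  apply mul_left_cancel₀ Complex.I_ne_zero
  rw [h]
  ring

/-- The number of surjections as a coefficient of `(exp z - 1) ^ n`, extracted by integration over the
circle of radius `a`. -/
theorem integral_exp_sub_one_pow (a : ℂ) (m n : ℕ) :
    ∫ θ in (-π)..π, (Complex.exp (a * Complex.exp (θ * Complex.I)) - 1) ^ n *
      Complex.exp (-(m * (θ * Complex.I))) =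
    2 * π * (a ^ m / m.factorial) *
      (Nat.card {g : Fin m → Fin n // Function.Surjective g} : ℂ) := by
  have hcard : (Nat.card {g : Fin m → Fin n // Function.Surjective g} : ℂ) =
      ∑ k ∈ Finset.range (n + 1), (n.choose k : ℂ) * ((-1) ^ k * ((n - k : ℕ) : ℂ) ^ m) := by
    exact_mod_cast congrArg (Int.cast : ℤ → ℂ) (card_surjective_eq_sum m n)
  have hexp : ∀ θ : ℝ, (Complex.exp (a * Complex.exp (θ * Complex.I)) - 1) ^ n *
      Complex.exp (-(m * (θ * Complex.I))) = ∑ k ∈ Finset.range (n + 1),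
        ((-1) ^ k * (n.choose k : ℂ)) *
          (Complex.exp ((n - k : ℕ) * a * Complex.exp (θ * Complex.I)) *
            Complex.exp (-(m * (θ * Complex.I)))) := by
    intro θ
    rw [sub_eq_neg_add, add_pow, Finset.sum_mul]
    refine Finset.sum_congr rfl fun k _ ↦ ?_
    rw [mul_assoc ((n - k : ℕ) : ℂ), Complex.exp_nat_mul]
    ring
  simp_rw [hexp]
  rw [intervalIntegral.integral_finsetSum
    (fun k _ ↦ Continuous.intervalIntegrable (by fun_prop) _ _), hcard, Finset.mul_sum]
  refine Finset.sum_congr rfl fun k _ ↦ ?_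
  rw [intervalIntegral.integral_const_mul, integral_exp_mul_exp_I_mul_exp_neg]
  ring
/-- Laplace's method for the integral of a high power: if `φ θ = 1 - s * θ ^ 2 + o(θ ^ 2)` near `0`
and `φ` is dominated by a Gaussian, then `√n * ∫ φ ^ n` tends to a Gaussian integral. -/
theorem tendsto_sqrt_mul_integral_pow {φ : ℝ → ℂ} {c s R : ℝ} (hR : 0 < R) (hc : 0 < c)
    (hφ : Continuous φ) (hbound : ∀ θ, |θ| ≤ R → ‖φ θ‖ ≤ exp (-c * θ ^ 2))
    (htaylor : (fun θ : ℝ ↦ φ θ - (1 - s * θ ^ 2)) =o[𝓝 0] fun θ : ℝ ↦ θ ^ 2) :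
    Tendsto (fun n : ℕ ↦ (√n : ℂ) * ∫ θ in (-R)..R, φ θ ^ n) atTop
      (𝓝 (∫ t : ℝ, Complex.exp (-s * t ^ 2))) := by
  have hrescale : ∀ᶠ n : ℕ in atTop,
      ∫ t : ℝ, (Set.Ioc (-R * √n) (R * √n)).indicator (fun t ↦ φ (t / √n) ^ n) t =
        (√n : ℂ) * ∫ θ in (-R)..R, φ θ ^ n := by
    filter_upwards [eventually_gt_atTop 0] with n hn
    have hn' : 0 < √(n : ℝ) := sqrt_pos.2 (by exact_mod_cast hn)
    rw [integral_indicator measurableSet_Ioc,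
      ← intervalIntegral.integral_of_le (by nlinarith [mul_pos hR hn']),
      intervalIntegral.integral_comp_div (fun θ ↦ φ θ ^ n) hn'.ne',
      mul_div_cancel_right₀ _ hn'.ne', mul_div_cancel_right₀ _ hn'.ne', Complex.real_smul]
  refine Tendsto.congr' hrescale ?_
  refine tendsto_integral_of_dominated_convergence (fun t ↦ exp (-c * t ^ 2)) (fun n ↦ ?_)
    (integrable_exp_neg_mul_sq hc) (fun n ↦ ?_) ?_
  · exact (Continuous.aestronglyMeasurable (by fun_prop)).indicator measurableSet_Ioc
  · refine Eventually.of_forall fun t ↦ ?_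
    by_cases ht : t ∈ Set.Ioc (-R * √n) (R * √n)
    · rw [Set.indicator_of_mem ht, norm_pow]
      have hn' : 0 < √(n : ℝ) := by
        by_contra! h
        have h0 : √(n : ℝ) = 0 := le_antisymm h (sqrt_nonneg _)
        simp [h0] at ht
      have hle : |t / √n| ≤ R := by
        rw [abs_div, abs_of_pos hn', div_le_iff₀ hn', abs_le]
        exact ⟨by linarith [ht.1], ht.2⟩
      refine (pow_le_pow_left₀ (norm_nonneg _) (hbound _ hle) n).trans_eq ?_
      rw [← exp_nat_mul, div_pow, sq_sqrt n.cast_nonneg]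
      have : (n : ℝ) ≠ 0 := (sqrt_pos.1 hn').ne'
      congr 1
      field_simp
    · rw [Set.indicator_of_notMem ht, norm_zero]
      positivity
  · refine Eventually.of_forall fun t ↦ ?_
    have hsqrt : Tendsto (fun n : ℕ ↦ √(n : ℝ)) atTop atTop :=
      tendsto_sqrt_atTop.comp tendsto_natCast_atTop_atTop
    have hmem : ∀ᶠ n : ℕ in atTop, φ (t / √n) ^ n =
        (Set.Ioc (-R * √n) (R * √n)).indicator (fun t ↦ φ (t / √n) ^ n) t := by
      filter_upwards [(hsqrt.const_mul_atTop hR).eventually_gt_atTop |t|] with n hn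
      rw [Set.indicator_of_mem]
      have := abs_lt.1 hn
      exact ⟨by linarith [this.1], this.2.le⟩
    refine Tendsto.congr' hmem ?_
    have hpow := Complex.tendsto_one_add_pow_exp_of_tendsto
      (g := fun n : ℕ ↦ φ (t / √n) - 1) (t := -s * t ^ 2) ?_
    · simpa using hpow
    have h0 : Tendsto (fun n : ℕ ↦ t / √(n : ℝ)) atTop (𝓝 0) := hsqrt.const_div_atTop t
    have hsq : (fun n : ℕ ↦ (t / √(n : ℝ)) ^ 2) =O[atTop] fun n : ℕ ↦ (n : ℝ)⁻¹ :=
      .of_bound (t ^ 2) (Eventually.of_forall fun n ↦ by simp [div_eq_mul_inv, mul_pow])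
    have hrem := (htaylor.comp_tendsto h0).trans_isBigO hsq
    have hlim : Tendsto (fun n : ℕ ↦ (n : ℂ) *
        (φ (t / √n) - (1 - s * ((t / √n : ℝ) : ℂ) ^ 2))) atTop (𝓝 0) := by
      rw [tendsto_zero_iff_norm_tendsto_zero]
      refine hrem.norm_left.tendsto_div_nhds_zero.congr fun n ↦ ?_
      simp [mul_comm]
    have hlim' := hlim.add_const (-s * t ^ 2 : ℂ)
    rw [zero_add] at hlim'
    refine hlim'.congr' ?_
    filter_upwards [eventually_gt_atTop 0] with n hn
    have hsq : ((√n : ℝ) : ℂ) ^ 2 = n := by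
      rw [← Complex.ofReal_pow, sq_sqrt n.cast_nonneg, Complex.ofReal_natCast]
    have : (n : ℂ) ≠ 0 := by exact_mod_cast hn.ne'
    rw [Complex.ofReal_div, div_pow, hsq]
    field_simp
    ring

/-- The characteristic function of `X - 2`, where `X` is a zero-truncated Poisson variable with
parameter `lam`. -/
noncomputable def centeredCharFun (lam θ : ℝ) : ℂ :=
  (Complex.exp (lam * Complex.exp (θ * Complex.I)) - 1) *
    Complex.exp (-(2 * (θ * Complex.I))) / (exp lam - 1 : ℝ)

theorem norm_centeredCharFun_le {lam : ℝ} (hlam : 0 < lam) :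
    ∃ c : ℝ, 0 < c ∧ ∀ θ, |θ| ≤ π → ‖centeredCharFun lam θ‖ ≤ exp (-c * θ ^ 2) := by
  have hK : 0 < exp lam - 1 := by linarith [add_one_lt_exp hlam.ne']
  set δ : ℝ := lam / (π ^ 2 * (1 + lam / 2)) with hδ
  have hδ0 : 0 < δ := by positivity
  refine ⟨lam * δ / (exp lam - 1), by positivity, fun θ hθ ↦ ?_⟩
  have hcos := cos_le_one_sub_mul_cos_sq hθ
  have hθsq : θ ^ 2 ≤ π ^ 2 := sq_le_sq' (abs_le.1 hθ).1 (abs_le.1 hθ).2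
  have hδπ : δ * π ^ 2 * (1 + lam / 2) = lam := by
    rw [hδ]; field_simp
  set w : ℂ := Complex.exp (θ * Complex.I) with hw
  have hwnorm : ‖w‖ = 1 := Complex.norm_exp_ofReal_mul_I θ
  have htwo : ‖1 + (lam / 2 : ℝ) * w‖ ≤ 1 + lam / 2 - δ * θ ^ 2 := by
    apply le_of_sq_le_sq
    · have : ‖1 + (lam / 2 : ℝ) * w‖ ^ 2 = (1 + lam / 2) ^ 2 - lam * (1 - cos θ) := by
        rw [← Complex.normSq_eq_norm_sq, Complex.normSq_apply, hw, Complex.exp_mul_I,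
          ← Complex.ofReal_cos, ← Complex.ofReal_sin]
        simp
        rw [Complex.cos_ofReal_re, Complex.sin_ofReal_re]
        nlinarith [sin_sq_add_cos_sq θ]
      rw [this]
      have h1 : lam * (2 / π ^ 2 * θ ^ 2) = 2 * (1 + lam / 2) * (δ * θ ^ 2) := by
        rw [hδ]; field_simp
      nlinarith [sq_nonneg (δ * θ ^ 2), mul_le_mul_of_nonneg_left hcos hlam.le]
    · have : δ * π ^ 2 ≤ 1 + lam / 2 := by
        by_contra! h
        nlinarith [mul_lt_mul_of_pos_right h (by positivity : 0 < 1 + lam / 2)]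
      nlinarith [mul_le_mul_of_nonneg_left hθsq hδ0.le]
  have htail := Complex.norm_exp_sub_sum_le_exp_norm_sub_sum (lam * w) 3
  simp only [Finset.sum_range_succ, Finset.sum_range_zero, norm_mul, hwnorm, Complex.norm_real,
    norm_of_nonneg hlam.le] at htail
  norm_num at htail
  have hnum : ‖Complex.exp (lam * w) - 1‖ ≤ exp lam - 1 - lam * δ * θ ^ 2 := by
    have hsplit : Complex.exp (lam * w) - 1 =
        (Complex.exp (lam * w) - (1 + lam * w + (lam * w) ^ 2 / 2)) +
          lam * w * (1 + (lam / 2 : ℝ) * w) := by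
      push_cast
      ring
    rw [hsplit]
    refine (norm_add_le _ _).trans ?_
    rw [norm_mul, norm_mul, hwnorm, Complex.norm_real, norm_of_nonneg hlam.le]
    nlinarith [mul_le_mul_of_nonneg_left htwo hlam.le]
  have hphase : ‖Complex.exp (-(2 * (θ * Complex.I)))‖ = 1 := by
    simp [Complex.norm_exp]
  rw [centeredCharFun, norm_div, norm_mul, hphase, mul_one, Complex.norm_real,
    norm_of_nonneg hK.le]
  refine le_trans ?_ (add_one_le_exp _)
  rw [div_le_iff₀ hK]
  refine hnum.trans_eq ?_
  field_simp
  ring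

theorem centeredCharFun_taylor {lam : ℝ} (hlam_pos : 0 < lam)
    (hlam : lam * exp lam = 2 * (exp lam - 1)) :
    (fun θ : ℝ ↦ centeredCharFun lam θ - (1 - (lam - 1 : ℝ) * θ ^ 2)) =o[𝓝 0]
      fun θ : ℝ ↦ θ ^ 2 := by
  have hK : (exp lam - 1 : ℝ) ≠ 0 := by linarith [add_one_lt_exp hlam_pos.ne']
  have hKc : (Complex.exp lam - 1 : ℂ) ≠ 0 := by exact_mod_cast hK
  have hlamc : lam * Complex.exp lam = 2 * (Complex.exp lam - 1) := by exact_mod_cast hlam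
  have hsmooth : ContDiff ℝ (2 : ℕ) (centeredCharFun lam) := by
    unfold centeredCharFun
    have : ContDiff ℝ (2 : ℕ) (fun θ : ℝ ↦ (θ : ℂ)) := Complex.ofRealCLM.contDiff
    fun_prop
  have hid (θ : ℝ) : HasDerivAt (fun θ : ℝ ↦ (θ : ℂ) * Complex.I) Complex.I θ := by
    simpa using (Complex.ofRealCLM.hasDerivAt (x := θ)).mul_const Complex.I
  have hderiv : deriv (centeredCharFun lam) = fun θ : ℝ ↦
      (Complex.I * (lam * Complex.exp (θ * Complex.I) - 2) *
        Complex.exp (lam * Complex.exp (θ * Complex.I)) + 2 * Complex.I) *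
          Complex.exp (-(2 * (θ * Complex.I))) / (exp lam - 1 : ℝ) := by
    funext θ
    refine HasDerivAt.deriv ?_
    convert! ((((hid θ).cexp.const_mul (lam : ℂ)).cexp.sub_const 1).mul
      ((hid θ).const_mul 2).neg.cexp).div_const ((exp lam - 1 : ℝ) : ℂ) using 1
    simp only [Pi.neg_apply]
    ring
  have hderiv2 : deriv (deriv (centeredCharFun lam)) 0 = ((-2 * (lam - 1) : ℝ) : ℂ) := by
    rw [hderiv]
    refine HasDerivAt.deriv ?_
    have h := ((((((hid 0).cexp.const_mul (lam : ℂ)).sub_const 2).const_mul Complex.I).mul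
      ((hid 0).cexp.const_mul (lam : ℂ)).cexp |>.add_const (2 * Complex.I)).mul
        ((hid 0).const_mul 2).neg.cexp).div_const ((exp lam - 1 : ℝ) : ℂ)
    convert! h using 1
    simp
    field_simp
    have hI : Complex.I ^ 2 = -1 := Complex.I_sq
    ring_nf
    simp only [hI]
    linear_combination (lam - 3 : ℂ) * hlamc
  have h := taylor_isLittleO_univ (x₀ := (0 : ℝ)) hsmooth
  simp only [taylor_within_apply, Finset.sum_range_succ, Finset.sum_range_zero,
    iteratedDerivWithin_univ, iteratedDeriv_zero, iteratedDeriv_succ, hderiv2,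
    sub_zero] at h
  refine h.congr_left fun θ ↦ ?_
  have h0 : centeredCharFun lam 0 = 1 := by
    simp [centeredCharFun, hKc]
  have h1 : deriv (centeredCharFun lam) 0 = 0 := by
    rw [hderiv]
    simp
    left
    linear_combination Complex.I * hlamc
  rw [h0, h1]
  simp
  ring

theorem exists_pos_bounds_of_tendsto_pos {r : ℕ → ℝ} {L : ℝ} (hL : 0 < L)
    (hr : Tendsto r atTop (𝓝 L)) (hpos : ∀ n, 1 ≤ n → 0 < r n) :
    ∃ c₁ c₂ : ℝ, 0 < c₁ ∧ 0 < c₂ ∧ ∀ n, 1 ≤ n → c₁ ≤ r n ∧ r n ≤ c₂ := by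
  obtain ⟨A, hA⟩ := hr.bddAbove_range
  obtain ⟨B, hB⟩ := (hr.inv₀ hL.ne').bddAbove_range
  have hA' (n : ℕ) : r n ≤ A := hA ⟨n, rfl⟩
  have hB' (n : ℕ) : (r n)⁻¹ ≤ B := hB ⟨n, rfl⟩
  have hA0 : 0 < A := (hpos 1 le_rfl).trans_le (hA' 1)
  have hB0 : 0 < B := (inv_pos.2 (hpos 1 le_rfl)).trans_le (hB' 1)
  exact ⟨B⁻¹, A, inv_pos.2 hB0, hA0, fun n hn ↦ ⟨inv_le_of_inv_le₀ (hpos n hn) (hB' n), hA' n⟩⟩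

theorem card_surjective_pos {m n : ℕ} (hn : 1 ≤ n) (hnm : n ≤ m) :
    0 < Nat.card {g : Fin m → Fin n // Function.Surjective g} := by
  have : Nonempty {g : Fin m → Fin n // Function.Surjective g} :=
    ⟨fun i ↦ ⟨i % n, Nat.mod_lt _ hn⟩, fun j ↦ ⟨⟨j, j.2.trans_le hnm⟩, by
      ext; exact Nat.mod_eq_of_lt j.2⟩⟩
  exact Nat.card_pos

theorem one_lt_of_mul_exp_eq {lam : ℝ} (hlam_pos : 0 < lam)
    (hlam : lam * exp lam = 2 * (exp lam - 1)) : 1 < lam := by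
  nlinarith [add_one_lt_exp hlam_pos.ne']

theorem integral_centeredCharFun_pow (lam : ℝ) (n : ℕ) :
    ∫ θ in (-π)..π, centeredCharFun lam θ ^ n =
      2 * π * (lam ^ (2 * n) / (2 * n).factorial) *
        (Nat.card {g : Fin (2 * n) → Fin n // Function.Surjective g} : ℂ) /
          (exp lam - 1 : ℝ) ^ n := by
  rw [← integral_exp_sub_one_pow, ← intervalIntegral.integral_div]
  congr 1 with θ
  rw [centeredCharFun, div_pow, mul_pow, ← Complex.exp_nat_mul]
  congr 3
  push_cast
  ring

theorem card_surjective_div_eq {lam : ℝ} (hlam_pos : 0 < lam)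
    (hlam : lam * exp lam = 2 * (exp lam - 1)) {n : ℕ} (hn : 1 ≤ n) :
    (((Nat.card {g : Fin (2 * n) → Fin n // Function.Surjective g} : ℝ) / (n : ℝ) ^ (2 * n) /
      (2 * exp lam / (lam * exp 1 ^ 2)) ^ n : ℝ) : ℂ) =
      (Stirling.stirlingSeq (2 * n) / π : ℝ) *
        ((√n : ℂ) * ∫ θ in (-π)..π, centeredCharFun lam θ ^ n) := by
  have hK : exp lam - 1 = lam * exp lam / 2 := by linarith
  have hn0 : (n : ℝ) ≠ 0 := by positivity
  have hsqrt : √(2 * (2 * n : ℝ)) = 2 * √n := by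
    rw [show (2 * (2 * n : ℝ)) = 2 ^ 2 * n by ring, sqrt_mul (by positivity),
      sqrt_sq (by norm_num)]
  rw [integral_centeredCharFun_pow, hK]
  norm_cast
  rw [Stirling.stirlingSeq]
  push_cast
  rw [hsqrt]
  have hs : √(n : ℝ) ≠ 0 := by positivity
  simp only [div_pow, mul_pow, pow_mul]
  field_simp
  simp only [← pow_mul]
  norm_num
  ring

theorem tendsto_card_surjective_div {lam : ℝ} (hlam_pos : 0 < lam)
    (hlam : lam * exp lam = 2 * (exp lam - 1)) :
    Tendsto (fun n : ℕ ↦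
      (Nat.card {g : Fin (2 * n) → Fin n // Function.Surjective g} : ℝ) / (n : ℝ) ^ (2 * n) /
        (2 * exp lam / (lam * exp 1 ^ 2)) ^ n) atTop
      (𝓝 (√π / π * √(π / (lam - 1)))) := by
  obtain ⟨c, hc, hbound⟩ := norm_centeredCharFun_le hlam_pos
  have hcont : Continuous (centeredCharFun lam) := by
    unfold centeredCharFun
    fun_prop
  have hint := tendsto_sqrt_mul_integral_pow pi_pos hc hcont hbound
    (centeredCharFun_taylor hlam_pos hlam)
  have hgauss : ∫ t : ℝ, Complex.exp (-(lam - 1 : ℝ) * t ^ 2) = (√(π / (lam - 1)) : ℝ) := by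
    rw [← integral_gaussian, ← integral_complex_ofReal]
    congr 1 with t
    push_cast
    rfl
  rw [hgauss] at hint
  have hstir : Tendsto (fun n : ℕ ↦ ((Stirling.stirlingSeq (2 * n) / π : ℝ) : ℂ)) atTop
      (𝓝 ((√π / π : ℝ) : ℂ)) :=
    (Complex.continuous_ofReal.tendsto _).comp
      ((Stirling.tendsto_stirlingSeq_sqrt_pi.comp
        (tendsto_id.const_mul_atTop' two_pos)).div_const π)
  have h := Complex.continuous_re.continuousAt.tendsto.comp (hstir.mul hint)
  rw [← Complex.ofReal_mul, Complex.ofReal_re] at h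
  refine h.congr' ?_
  filter_upwards [eventually_ge_atTop 1] with n hn
  rw [Function.comp_apply, ← card_surjective_div_eq hlam_pos hlam hn, Complex.ofReal_re]

theorem surjection_probability_theta (lam : ℝ) (hlam_pos : 0 < lam)
    (hlam : lam / (1 - Real.exp (-lam)) = 2)
    (b : ℝ) (hb : b = 2 * Real.exp lam / (lam * Real.exp 1 ^ 2)) :
    ∃ c₁ c₂ : ℝ, 0 < c₁ ∧ 0 < c₂ ∧ ∀ n : ℕ, 1 ≤ n →
      c₁ * b ^ n ≤
        (Nat.card {g : Fin (2 * n) → Fin n // Function.Surjective g} : ℝ) /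
          (n : ℝ) ^ (2 * n) ∧
      (Nat.card {g : Fin (2 * n) → Fin n // Function.Surjective g} : ℝ) /
          (n : ℝ) ^ (2 * n) ≤ c₂ * b ^ n := by
  have hmean : lam * exp lam = 2 * (exp lam - 1) := by
    have hne : 1 - exp (-lam) ≠ 0 := by
      have : exp (-lam) < 1 := by
        rw [← exp_zero]
        exact exp_lt_exp.2 (by linarith)
      linarith
    rw [div_eq_iff hne, exp_neg] at hlam
    field_simp at hlam
    linarith
  have hlam_one := one_lt_of_mul_exp_eq hlam_pos hmean
  have hb_pos : 0 < b := by rw [hb]; positivity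
  have hlim := tendsto_card_surjective_div hlam_pos hmean
  rw [← hb] at hlim
  have hL : 0 < √π / π * √(π / (lam - 1)) := by
    have : 0 < lam - 1 := by linarith
    positivity
  obtain ⟨c₁, c₂, hc₁, hc₂, h⟩ := exists_pos_bounds_of_tendsto_pos hL hlim fun n hn ↦ by
    have : (0 : ℝ) < Nat.card {g : Fin (2 * n) → Fin n // Function.Surjective g} :=
      mod_cast card_surjective_pos hn (by omega)
    positivity
  refine ⟨c₁, c₂, hc₁, hc₂, fun n hn ↦ ?_⟩
  rw [← le_div_iff₀ (pow_pos hb_pos n), ← div_le_iff₀ (pow_pos hb_pos n)]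
  exact h n hn
end
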